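/- arXiv:1508.04107 — 2 statements merged into one kernel-verified Lean document; each statement's English description precedes it below -/
import Mathlib

section
/- Let D be a small category, k a commutative ring, and suppose D admits a homological modulus μ over k such that all hom-sets of D are finite and k is Artinian. Then every finitely generated representation V of D (generated in degrees {d_1,…,d_l} with each V(d_i) finitely generated over k) has finite length in Rep_k(D). -/
open CategoryTheory

/-- The 0-1 matrix `M_s` indexed by `Hom(d,x)` recording the pairs `(f,g)` with `s ∘ f = g`. -/
noncomputable def Msmat {D : Type*} [Category D] (k : Type*) [CommRing k] (d x : D) (s : x ⟶ x) :
    Matrix (d ⟶ x) (d ⟶ x) k :=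
  fun f g => letI := Classical.dec (f ≫ s = g); if f ≫ s = g then 1 else 0

/-- `x ≤_d y` : the identity matrix lies in the `k`-span of the matrices `M_s`
for `s` an endomorphism of `x` factoring through `y`. -/
def LeD {D : Type*} [Category D] (k : Type*) [CommRing k] (d x y : D) : Prop :=
  letI := Classical.decEq (d ⟶ x)
  (1 : Matrix (d ⟶ x) (d ⟶ x) k) ∈
    Submodule.span k {M : Matrix (d ⟶ x) (d ⟶ x) k |
      ∃ (p : x ⟶ y) (q : y ⟶ x), M = Msmat k d x (p ≫ q)}

/-- A subrepresentation of a functor `V : D ⥤ Mod_k`: a submodule at each object,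
closed under the action of all arrows. -/
structure Subrep (k : Type) [CommRing k] {D : Type} [SmallCategory D]
    (V : D ⥤ ModuleCat k) where
  toFun : ∀ x : D, Submodule k (V.obj x)
  map_mem : ∀ {x y : D} (f : x ⟶ y), ∀ v ∈ toFun x, V.map f v ∈ toFun y

instance {k : Type} [CommRing k] {D : Type} [SmallCategory D] {V : D ⥤ ModuleCat k} :
    PartialOrder (Subrep k V) where
  le W W' := ∀ x, W.toFun x ≤ W'.toFun x
  le_refl W x := le_refl _
  le_trans a b c h h' x := le_trans (h x) (h' x)
  le_antisymm a b h h' := by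
    cases a; cases b
    congr 1
    funext x
    exact le_antisymm (h x) (h' x)

namespace Subrep

variable {k : Type} [CommRing k] {D : Type} [SmallCategory D] {V : D ⥤ ModuleCat k}

/-- The subrepresentation generated by the value of `V` at the object `d`. -/
def generatedAt (V : D ⥤ ModuleCat k) (d : D) : Subrep k V where
  toFun x := ⨆ f : d ⟶ x, LinearMap.range (V.map f).hom
  map_mem {x y} g v hv := by
    have h : (⨆ f : d ⟶ x, LinearMap.range (V.map f).hom) ≤
        (⨆ f : d ⟶ y, LinearMap.range (V.map f).hom).comap (V.map g).hom := by
      refine iSup_le fun f => ?_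
      rintro _ ⟨u, rfl⟩
      refine Submodule.mem_iSup_of_mem (f ≫ g) ⟨u, ?_⟩
      simp
    exact h hv

lemma generatedAt_self (d : D) : (generatedAt V d).toFun d = ⊤ := by
  refine eq_top_iff.2 fun v _ => Submodule.mem_iSup_of_mem (𝟙 d) ⟨v, ?_⟩
  simp

/-- The supremum of a family of subrepresentations, computed objectwise. -/
def supFamily {ι : Type*} (W : ι → Subrep k V) : Subrep k V where
  toFun x := ⨆ i, (W i).toFun x
  map_mem {x y} g v hv := by
    have h : (⨆ i, (W i).toFun x) ≤ (⨆ i, (W i).toFun y).comap (V.map g).hom :=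
      iSup_le fun i u hu => Submodule.mem_iSup_of_mem i ((W i).map_mem g u hu)
    exact h hv

lemma iSup_generatedAt_eq_top {ι : Type*} {d : ι → D}
    (hgen : ∀ W : Subrep k V, (∀ i, W.toFun (d i) = ⊤) → ∀ x, W.toFun x = ⊤) (x : D) :
    ⨆ i, (generatedAt V (d i)).toFun x = ⊤ :=
  hgen (supFamily fun i => generatedAt V (d i))
    (fun i => eq_top_iff.2 <| (generatedAt_self (V := V) (d i)).ge.trans
      (le_iSup (fun j => (generatedAt V (d j)).toFun (d i)) i)) x

/-- The span of the action on `V.obj x` of the endomorphisms of `x` that factor through `y`. -/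
def factorSpan (V : D ⥤ ModuleCat k) (x y : D) : Submodule k (Module.End k (V.obj x)) :=
  Submodule.span k {a | ∃ (p : x ⟶ y) (q : y ⟶ x), a = (V.map (p ≫ q)).hom}

lemma factorSpan_apply_mem {x y : D} {a : Module.End k (V.obj x)} (ha : a ∈ factorSpan V x y)
    {W W' : Subrep k V} (h : W.toFun y ≤ W'.toFun y) {w : V.obj x} (hw : w ∈ W.toFun x) :
    a w ∈ W'.toFun x := by
  have hle : factorSpan V x y ≤ (W'.toFun x).comap (LinearMap.applyₗ w) := by
    refine Submodule.span_le.2 ?_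
    rintro _ ⟨p, q, rfl⟩
    have := W'.map_mem q _ (h (W.map_mem p w hw))
    simpa using this
  exact hle ha

lemma exists_factorSpan_of_mem_span (d x y : D) [Fintype (d ⟶ x)] {M : Matrix (d ⟶ x) (d ⟶ x) k}
    (hM : M ∈ Submodule.span k {M : Matrix (d ⟶ x) (d ⟶ x) k |
      ∃ (p : x ⟶ y) (q : y ⟶ x), M = Msmat k d x (p ≫ q)}) :
    ∃ a ∈ factorSpan V x y, ∀ (f : d ⟶ x) (v : V.obj d),
      a ((V.map f).hom v) = ∑ g, M f g • (V.map g).hom v := by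
  induction hM using Submodule.span_induction with
  | mem M hM =>
    obtain ⟨p, q, rfl⟩ := hM
    refine ⟨_, Submodule.subset_span ⟨p, q, rfl⟩, fun f v => ?_⟩
    rw [Finset.sum_eq_single (f ≫ p ≫ q)]
    · simp [Msmat]
    · intro g _ hg
      rw [Msmat, if_neg hg.symm, zero_smul]
    · exact fun h => absurd (Finset.mem_univ _) h
  | zero => exact ⟨0, zero_mem _, by simp⟩
  | add M N _ _ hM hN =>
    obtain ⟨a, ha, ha'⟩ := hM
    obtain ⟨b, hb, hb'⟩ := hN
    exact ⟨a + b, add_mem ha hb, fun f v => by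
      simp [ha', hb', add_smul, Finset.sum_add_distrib]⟩
  | smul c M _ hM =>
    obtain ⟨a, ha, ha'⟩ := hM
    exact ⟨c • a, Submodule.smul_mem _ c ha, fun f v => by
      simp [ha', mul_smul, Finset.smul_sum]⟩

lemma exists_factorSpan_eq_self [∀ x y : D, Finite (x ⟶ y)] {d x y : D} (h : LeD k d x y) :
    ∃ a ∈ factorSpan V x y, ∀ v ∈ (generatedAt V d).toFun x, a v = v := by
  classical
  have := Fintype.ofFinite (d ⟶ x)
  obtain ⟨a, ha, ha'⟩ := exists_factorSpan_of_mem_span (V := V) d x y h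
  refine ⟨a, ha, fun v hv => ?_⟩
  have hle : (generatedAt V d).toFun x ≤ LinearMap.eqLocus a LinearMap.id := by
    refine iSup_le fun f => ?_
    rintro _ ⟨u, rfl⟩
    simp [ha', Matrix.one_apply, ite_smul]
  exact hle hv

/-- An operator on `V.obj x` that vanishes on everything generated from the degrees in `s`,
preserves all subrepresentations, and differs from the identity by an operator mapping `W` into
`W'`. -/
lemma exists_annihilator [∀ x y : D, Finite (x ⟶ y)] {ι : Type*} {d : ι → D} {x : D}
    {W W' : Subrep k V} (h : ∀ i, ∃ y, LeD k (d i) x y ∧ W.toFun y ≤ W'.toFun y)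
    (s : Finset ι) :
    ∃ b : Module.End k (V.obj x),
      (∀ i ∈ s, ∀ v ∈ (generatedAt V (d i)).toFun x, b v = 0) ∧
      (∀ (P : Subrep k V), ∀ v ∈ P.toFun x, b v ∈ P.toFun x) ∧
      ∀ w ∈ W.toFun x, w - b w ∈ W'.toFun x := by
  classical
  induction s using Finset.induction_on with
  | empty => exact ⟨LinearMap.id, by simp, by simp, by simp⟩
  | insert i s _ ih =>
    obtain ⟨b, hb, hbP, hbW⟩ := ih
    obtain ⟨y, hy, hle⟩ := h i
    obtain ⟨a, ha, ha'⟩ := exists_factorSpan_eq_self (V := V) hy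
    refine ⟨b - a * b, fun j hj v hv => ?_, fun P v hv => ?_, fun w hw => ?_⟩
    · rcases Finset.mem_insert.1 hj with rfl | hj
      · simp [ha' _ (hbP _ v hv)]
      · simp [hb j hj v hv]
    · exact sub_mem (hbP P v hv) (factorSpan_apply_mem ha le_rfl (hbP P v hv))
    · have := add_mem (hbW w hw) (factorSpan_apply_mem ha hle (hbP W w hw))
      simpa [sub_sub_eq_add_sub, sub_add_eq_add_sub] using this

/-- Every subrepresentation of `V` is determined by its values at a homological modulus of the
generating degrees of `V`. -/
lemma le_of_le_modulus [∀ x y : D, Finite (x ⟶ y)] {ι : Type*} [Finite ι] {d : ι → D}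
    {μ : D → Set D} (hμ : ∀ d x : D, ∃ y ∈ μ d, LeD k d x y)
    (hgen : ∀ W : Subrep k V, (∀ i, W.toFun (d i) = ⊤) → ∀ x, W.toFun x = ⊤)
    {W W' : Subrep k V} (h : ∀ y ∈ ⋃ i, μ (d i), W.toFun y ≤ W'.toFun y) : W ≤ W' := by
  intro x w hw
  have := Fintype.ofFinite ι
  obtain ⟨b, hb, -, hbW⟩ := exists_annihilator (d := d) (x := x) (W := W) (W' := W')
    (fun i => by
      obtain ⟨y, hy, hle⟩ := hμ (d i) x
      exact ⟨y, hle, h y (Set.mem_iUnion_of_mem i hy)⟩) Finset.univ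
  have hker : (⊤ : Submodule k (V.obj x)) ≤ LinearMap.ker b := by
    rw [← iSup_generatedAt_eq_top hgen x]
    exact iSup_le fun i v hv => hb i (Finset.mem_univ i) v hv
  have hbw : b w = 0 := hker (Submodule.mem_top (x := w))
  simpa [hbw] using hbW w hw

lemma finite_obj [∀ x y : D, Finite (x ⟶ y)] {ι : Type*} [Finite ι] {d : ι → D}
    (hgen : ∀ W : Subrep k V, (∀ i, W.toFun (d i) = ⊤) → ∀ x, W.toFun x = ⊤)
    (hfg : ∀ i, Module.Finite k (V.obj (d i))) (x : D) : Module.Finite k (V.obj x) := by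
  refine ⟨?_⟩
  rw [← iSup_generatedAt_eq_top hgen x]
  exact Submodule.fg_iSup _ fun i => Submodule.fg_iSup _ fun f =>
    Module.Finite.iff_fg.1 inferInstance

end Subrep

/-- If `D` admits a homological modulus `μ` over an Artinian commutative ring `k` and all
hom-sets of `D` are finite, then every finitely generated representation of `D`
(generated in degrees `d 0, …, d (l-1)` with each `V (d i)` finitely generated over `k`)
has finite length: its lattice of subrepresentations satisfies both chain conditions. -/
theorem stmt16 (k : Type) [CommRing k] (hart : IsArtinianRing k)
    {D : Type} [SmallCategory D]
    (hfin : ∀ x y : D, Finite (x ⟶ y))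
    (μ : D → Set D) (hμfin : ∀ d : D, (μ d).Finite)
    (hμ : ∀ d x : D, ∃ y ∈ μ d, LeD k d x y)
    (V : D ⥤ ModuleCat k) (l : ℕ) (d : Fin l → D)
    (hgen : ∀ W : Subrep k V, (∀ i, W.toFun (d i) = ⊤) → ∀ x, W.toFun x = ⊤)
    (hfg : ∀ i, Module.Finite k (V.obj (d i))) :
    WellFoundedLT (Subrep k V) ∧ WellFoundedGT (Subrep k V) := by
  have hfinite := Subrep.finite_obj hgen hfg
  have : Finite ↥(⋃ i, μ (d i)) := Set.finite_iUnion fun i => hμfin (d i)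
  let e : Subrep k V → ∀ y : ↥(⋃ i, μ (d i)), Submodule k (V.obj y) := fun W y => W.toFun y
  have he : StrictMono e := fun W W' h =>
    lt_of_le_not_ge (fun y => h.le y) fun hge =>
      h.not_ge (Subrep.le_of_le_modulus hμ hgen fun y hy => hge ⟨y, hy⟩)
  have : WellFoundedLT (∀ y : ↥(⋃ i, μ (d i)), (Submodule k (V.obj y))ᵒᵈ) := inferInstance
  have : WellFoundedGT (∀ y : ↥(⋃ i, μ (d i)), Submodule k (V.obj y)) := ⟨this.wf⟩
  exact ⟨he.wellFoundedLT, he.wellFoundedGT⟩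
end

section
/- Let D be a small category, k a commutative ring, and d an object such that the monoid algebra k[End_D(d)] fails the descending chain condition on right ideals. Then the representation P^d = k[Hom_D(d,−)] of D admits an infinite strictly decreasing chain of subrepresentations; in particular D is not dimension zero over k. -/
open CategoryTheory

/-- The basic projective `P^d = k[Hom_D(d, -)]`. -/
noncomputable def Pd (k : Type) [CommRing k] {D : Type} [SmallCategory D] (d : D) :
    D ⥤ ModuleCat k :=
  coyoneda.obj (Opposite.op d) ⋙ ModuleCat.free k

/-- `V` is finitely generated: finitely many vectors span `V` using scalars from `k`
and arrows from `D`. -/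
def IsFinGen (k : Type) [CommRing k] {D : Type} [SmallCategory D]
    (V : D ⥤ ModuleCat k) : Prop :=
  ∃ (l : ℕ) (d : Fin l → D) (v : ∀ i, V.obj (d i)),
    ∀ W : Subrep k V, (∀ i, v i ∈ W.toFun (d i)) → ∀ x, W.toFun x = ⊤

/-- `V` has finite length: both chain conditions hold on subrepresentations. -/
def IsFinLength (k : Type) [CommRing k] {D : Type} [SmallCategory D]
    (V : D ⥤ ModuleCat k) : Prop :=
  WellFoundedLT (Subrep k V) ∧ WellFoundedGT (Subrep k V)

/-- `D` is dimension zero over `k`: every finitely generated representation has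
finite length. -/
def DimZero (k : Type) [CommRing k] (D : Type) [SmallCategory D] : Prop :=
  ∀ V : D ⥤ ModuleCat.{0} k, IsFinGen k V → IsFinLength k V

section Ring

/-- The property of being left Artinian passes along an additive map `π : R →+ S` which is linear
with respect to right multiplication by the images of a map `ι : S → R`. -/
lemma IsArtinianRing.of_addMonoidHom {R S : Type*} [Ring R] [Ring S] [IsArtinianRing R]
    (π : R →+ S) (ι : S → R) (h : ∀ r s, π (r * ι s) = π r * s) (h1 : π 1 = 1) :
    IsArtinianRing S := by
  let Φ : Ideal S → Ideal R := fun L ↦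
    { carrier := {a | ∀ b, π (b * a) ∈ L}
      add_mem' := fun {x y} hx hy b ↦ by
        rw [mul_add, map_add]; exact add_mem (hx b) (hy b)
      zero_mem' := fun b ↦ by simp
      smul_mem' := fun c x hx b ↦ by
        rw [smul_eq_mul, ← mul_assoc]; exact hx _ }
  have mem (L : Ideal S) (s : S) : ι s ∈ Φ L ↔ s ∈ L := by
    refine ⟨fun hs ↦ ?_, fun hs b ↦ ?_⟩
    · have := hs 1
      rwa [h, h1, one_mul] at this
    rw [h]; exact L.mul_mem_left _ hs
  have hΦ : StrictMono Φ := by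
    refine Monotone.strictMono_of_injective (fun L L' hL a ha b ↦ hL (ha b)) fun L L' hL ↦ ?_
    ext s; rw [← mem, ← mem, hL]
  exact hΦ.wellFoundedLT

end Ring

namespace MonoidAlgebra

section Group

variable {K G : Type*} [Group G]

lemma coeff_mul_one_eq_sum [Semiring K] (a b : MonoidAlgebra K G) :
    (a * b).coeff 1 = ∑ g ∈ a.coeff.support, a.coeff g * b.coeff g⁻¹ := by
  classical
  rw [coeff_mul, Finsupp.sum]
  refine Finset.sum_congr rfl fun g _ ↦ ?_
  rw [Finsupp.sum, Finset.sum_eq_single g⁻¹]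
  · simp
  · intro h _ hne
    rw [if_neg]
    exact fun hgh ↦ hne (eq_inv_of_mul_eq_one_right hgh)
  · intro hb
    simp [Finsupp.notMem_support_iff.1 hb]

section Subgroup

variable [Ring K]

/-- The left ideal of the group algebra generated by the augmentation ideal of a subgroup. -/
noncomputable def subgroupIdeal (K : Type*) {G : Type*} [Ring K] [Group G] (H : Subgroup G) :
    Ideal (MonoidAlgebra K G) :=
  Ideal.span {a | ∃ h ∈ H, a = single h 1 - 1}

lemma subgroupIdeal_mono : Monotone (subgroupIdeal K : Subgroup G → _) :=
  fun _ _ hH ↦ Ideal.span_mono fun _ ⟨h, hh, ha⟩ ↦ ⟨h, hH hh, ha⟩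

lemma single_sub_one_mem_subgroupIdeal_iff [Nontrivial K] {H : Subgroup G} {g : G} :
    (single g 1 - 1 : MonoidAlgebra K G) ∈ subgroupIdeal K H ↔ g ∈ H := by
  classical
  refine ⟨fun hg ↦ ?_, fun hg ↦ Ideal.subset_span ⟨g, hg, rfl⟩⟩
  let φ : MonoidAlgebra K G →+ K :=
    (Finsupp.liftAddHom fun x : G ↦ if x ∈ H then AddMonoidHom.id K else 0).comp
      (coeffAddEquiv (R := K) (M := G)).toAddMonoidHom
  have hφ (x : G) (r : K) : φ (single x r) = if x ∈ H then r else 0 := by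
    simp only [φ, AddMonoidHom.comp_apply]
    erw [Finsupp.liftAddHom_apply_single]
    split_ifs <;> rfl
  have key : ∀ a ∈ subgroupIdeal K H, φ a = 0 := by
    intro a ha
    let L : Ideal (MonoidAlgebra K G) :=
      { carrier := {a | ∀ b, φ (b * a) = 0}
        add_mem' := fun {x y} hx hy b ↦ by rw [mul_add, map_add, hx, hy, add_zero]
        zero_mem' := fun b ↦ by simp
        smul_mem' := fun c x hx b ↦ by rw [smul_eq_mul, ← mul_assoc]; exact hx _ }
    have hL : subgroupIdeal K H ≤ L := by
      refine Ideal.span_le.2 ?_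
      rintro _ ⟨h, hh, rfl⟩ b
      induction b using MonoidAlgebra.induction_linear with
      | zero => simp
      | add x y hx hy => rw [add_mul, map_add, hx, hy, add_zero]
      | single x r =>
        rw [mul_sub, mul_one, single_mul_single, mul_one, map_sub, hφ, hφ,
          H.mul_mem_cancel_right hh, sub_self]
    simpa using hL ha 1
  have := key _ hg
  rw [map_sub, one_def, hφ, hφ, if_pos H.one_mem] at this
  by_contra hgH
  simp [hgH] at this

lemma subgroupIdeal_strictMono [Nontrivial K] :
    StrictMono (subgroupIdeal K : Subgroup G → _) :=
  subgroupIdeal_mono.strictMono_of_injective fun H H' h ↦ by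
    ext g
    rw [← single_sub_one_mem_subgroupIdeal_iff (K := K), h, single_sub_one_mem_subgroupIdeal_iff]

lemma isMulTorsion_of_wellFoundedLT [WellFoundedLT (Subgroup G)] (g : G) : IsOfFinOrder g := by
  obtain ⟨n, hn⟩ := WellFoundedGT.monotone_chain_condition (α := (Subgroup G)ᵒᵈ)
    ⟨fun n ↦ OrderDual.toDual (Subgroup.zpowers (g ^ 2 ^ n)), monotone_nat_of_le_succ fun n ↦ by
      rw [OrderDual.toDual_le_toDual, Subgroup.zpowers_le, pow_succ 2 n, pow_mul]
      exact Subgroup.npow_mem_zpowers _ 2⟩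
  have h : g ^ 2 ^ n ∈ Subgroup.zpowers (g ^ 2 ^ (n + 1)) := by
    have := hn (n + 1) n.le_succ
    simp only [OrderHom.coe_mk, OrderDual.toDual_inj] at this
    rw [← this]
    exact Subgroup.mem_zpowers _
  obtain ⟨z, hz⟩ := Subgroup.mem_zpowers_iff.1 h
  by_contra hg
  rw [← zpow_natCast, ← zpow_natCast, ← zpow_mul] at hz
  have := injective_zpow_iff_not_isOfFinOrder.2 hg hz
  push_cast [pow_succ, mul_assoc] at this
  have h2 := mul_left_cancel₀ (pow_ne_zero n two_ne_zero) (this.trans (mul_one _).symm)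
  omega

end Subgroup

/-- In the group algebra of a group with infinite conjugacy classes, the product of two nonzero
left ideals is nonzero. -/
lemma eq_bot_or_eq_bot_of_mul_eq_bot [Ring K] [NoZeroDivisors K]
    (hG : ∀ g : G, g ≠ 1 → ¬ (Subgroup.centralizer {g}).FiniteIndex)
    {I J : Ideal (MonoidAlgebra K G)} (hIJ : I * J = ⊥) : I = ⊥ ∨ J = ⊥ := by
  classical
  have key : ∀ a ∈ I, ∀ b ∈ J, a.coeff 1 * b.coeff 1 = 0 := by
    intro a ha b hb
    obtain ⟨x, hx⟩ : ∃ x : G, ∀ g ∈ a.coeff.support, g ≠ 1 → b.coeff (x * g⁻¹ * x⁻¹) = 0 := by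
      by_contra! hcon
      let s : Finset (G × G) := (a.coeff.support.filter (· ≠ 1)) ×ˢ b.coeff.support
      have hy : ∀ p : G × G, ∃ y : G, (∃ x, x * p.1⁻¹ * x⁻¹ = p.2) → y * p.1⁻¹ * y⁻¹ = p.2 := by
        intro p
        by_cases hp : ∃ x, x * p.1⁻¹ * x⁻¹ = p.2
        · exact ⟨hp.choose, fun _ ↦ hp.choose_spec⟩
        · exact ⟨1, fun h ↦ absurd h hp⟩
      choose y hy using hy
      obtain ⟨p, hp, hfin⟩ := Subgroup.exists_finiteIndex_of_leftCoset_cover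
        (H := fun p : G × G ↦ Subgroup.centralizer {p.1}) (g := y) (s := s) (by
          rw [Set.eq_univ_iff_forall]
          intro x
          obtain ⟨g, hg, hg1, hgb⟩ := hcon x
          have hs : (g, x * g⁻¹ * x⁻¹) ∈ s := by
            simp only [s, Finset.mem_product, Finset.mem_filter]
            exact ⟨⟨hg, hg1⟩, Finsupp.mem_support_iff.2 hgb⟩
          refine Set.mem_iUnion₂.2 ⟨_, hs, ?_⟩
          rw [mem_leftCoset_iff, SetLike.mem_coe, Subgroup.mem_centralizer_singleton_iff]
          have := hy (g, x * g⁻¹ * x⁻¹) ⟨x, rfl⟩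
          simp only at this ⊢
          set z := y (g, x * g⁻¹ * x⁻¹)
          have h2 : z * g * z⁻¹ = x * g * x⁻¹ := by
            have := congrArg (·⁻¹) this
            simpa [mul_assoc] using this
          have h3 : g = z⁻¹ * x * g * x⁻¹ * z := by
            calc g = z⁻¹ * (z * g * z⁻¹) * z := by group
              _ = _ := by rw [h2]; group
          calc _ = z⁻¹ * x * g * x⁻¹ * z * (z⁻¹ * x) := by group
            _ = _ := by rw [← h3])
      simp only [s, Finset.mem_product, Finset.mem_filter] at hp
      exact hG p.1 hp.1.2 hfin
    have h0 : a * (single x⁻¹ 1 * b) = 0 := by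
      rw [← Ideal.mem_bot, ← hIJ]
      exact Ideal.mul_mem_mul ha (J.mul_mem_left _ hb)
    have h1 : (a * (single x⁻¹ 1 * b * single x 1)).coeff 1 = 0 := by
      rw [← mul_assoc, h0]; simp
    rw [coeff_mul_one_eq_sum, Finset.sum_eq_single 1] at h1
    · simpa using h1
    · intro g hg hg1
      have := hx g hg hg1
      simp [mul_assoc] at this ⊢
      simp [this]
    · intro h
      simp [Finsupp.notMem_support_iff.1 h]
  by_contra! hne
  obtain ⟨a, ha, ha0⟩ := Submodule.exists_mem_ne_zero_of_ne_bot hne.1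
  obtain ⟨b, hb, hb0⟩ := Submodule.exists_mem_ne_zero_of_ne_bot hne.2
  obtain ⟨g, hg⟩ : ∃ g, a.coeff g ≠ 0 := by
    by_contra! h; exact ha0 (by ext g; simpa using h g)
  obtain ⟨h, hh⟩ : ∃ g, b.coeff g ≠ 0 := by
    by_contra! h; exact hb0 (by ext g; simpa using h g)
  have := key _ (I.mul_mem_left (single g⁻¹ 1) ha) _ (J.mul_mem_left (single h⁻¹ 1) hb)
  simp at this
  tauto

/-- A group with infinite conjugacy classes and left Artinian group algebra is finite. -/
lemma finite_of_forall_not_finiteIndex_centralizer [Field K]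
    [IsArtinianRing (MonoidAlgebra K G)]
    (hG : ∀ g : G, g ≠ 1 → ¬ (Subgroup.centralizer {g}).FiniteIndex) : Finite G := by
  have hpow : ∀ n, Ring.jacobson (MonoidAlgebra K G) ^ n = ⊥ →
      Ring.jacobson (MonoidAlgebra K G) = ⊥ := by
    intro n
    induction n with
    | zero => 
      intro h
      rw [Submodule.pow_zero, Ideal.one_eq_top] at h
      exact le_bot_iff.1 (h ▸ le_top)
    | succ n ih =>
      intro h
      rw [Submodule.pow_succ] at h
      exact (eq_bot_or_eq_bot_of_mul_eq_bot hG h).elim ih id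
  obtain ⟨n, hn⟩ := IsSemiprimaryRing.isNilpotent (R := MonoidAlgebra K G)
  have hss : IsSemisimpleModule (MonoidAlgebra K G) (MonoidAlgebra K G) :=
    (IsArtinian.isSemisimpleModule_iff_jacobson _ _).2 (hpow n hn)
  let ε : MonoidAlgebra K G →+* K := (MonoidAlgebra.lift K K G 1 : _ →ₐ[K] K)
  have hε (g : G) : ε (single g 1) = 1 := by simp [ε]
  obtain ⟨I, hI⟩ := exists_isCompl (RingHom.ker ε)
  have hne : I ≠ ⊥ := by
    rintro rfl
    exact RingHom.ker_ne_top ε (by simpa using hI.sup_eq_top)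
  obtain ⟨x, hx, hx0⟩ := Submodule.exists_mem_ne_zero_of_ne_bot hne
  have hinv (g : G) : single g 1 * x = x := by
    have h1 : (single g 1 - 1) * x ∈ RingHom.ker ε ⊓ I :=
      ⟨by simp [RingHom.mem_ker, hε], I.mul_mem_left _ hx⟩
    rw [hI.inf_eq_bot, Submodule.mem_bot, sub_mul, one_mul, sub_eq_zero] at h1
    exact h1
  obtain ⟨g, hg⟩ : ∃ g, x.coeff g ≠ 0 := by
    by_contra! h; exact hx0 (by ext g; simpa using h g)
  refine Set.finite_univ_iff.1 (x.coeff.support.finite_toSet.subset fun h _ ↦ ?_)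
  simp only [Finset.mem_coe, Finsupp.mem_support_iff]
  rw [← hinv (h * g⁻¹)]
  simpa using hg

/-- A group whose subgroups satisfy both chain conditions and whose nontrivial normal subgroups have
finite index is finite as soon as it has a nontrivial finite conjugacy class. -/
lemma finite_of_finiteIndex_centralizer [WellFoundedLT (Subgroup G)] [WellFoundedGT (Subgroup G)]
    (hG : ∀ P : Subgroup G, P.Normal → P ≠ ⊥ → P.FiniteIndex)
    {g : G} (hg : g ≠ 1) (hgi : (Subgroup.centralizer {g}).FiniteIndex) : Finite G := by
  let C := (Subgroup.centralizer {g}).normalCore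
  have hCi : C.FiniteIndex := inferInstance
  have hC : (Subgroup.centralizer (C : Set G)).FiniteIndex := by
    refine hG _ inferInstance fun h ↦ hg ?_
    rw [← Subgroup.mem_bot, ← h, Subgroup.mem_centralizer_iff]
    exact fun x hx ↦ (Subgroup.mem_centralizer_singleton_iff.1 (Subgroup.normalCore_le _ hx))
  let B := C ⊓ Subgroup.centralizer (C : Set G)
  have hB : B.FiniteIndex := inferInstance
  let _ : CommGroup B :=
    { mul_comm := fun x y ↦ Subtype.ext (Subgroup.mem_centralizer_iff.1 y.2.2 x x.2.1) }
  have hfg : B.FG := by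
    classical
    obtain ⟨_, ⟨t, ht, rfl⟩, hmax⟩ := wellFounded_gt.has_min
      {H : Subgroup G | ∃ t : Finset G, (t : Set G) ⊆ B ∧ H = Subgroup.closure t}
      ⟨_, ∅, by simp, rfl⟩
    refine ⟨t, le_antisymm ((Subgroup.closure_le _).2 ht) fun b hb ↦ ?_⟩
    by_contra hbt
    refine hmax _ ⟨insert b t, by simp [Set.insert_subset_iff, ht, hb], rfl⟩ ?_
    refine lt_of_le_of_ne (Subgroup.closure_mono (by simp)) fun h ↦ hbt ?_
    rw [h]
    exact Subgroup.subset_closure (by simp)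
  have : Group.FG B := (Group.fg_iff_subgroup_fg B).2 hfg
  have : Finite B := CommGroup.finite_of_fg_isMulTorsion B fun x ↦
    Submonoid.isOfFinOrder_coe (H := B.toSubmonoid) |>.1 (isMulTorsion_of_wellFoundedLT (x : G))
  exact Finite.of_subgroup_quotient (H := B)

/-- A group with left Artinian group algebra over a field is finite. -/
theorem finite_of_isArtinianRing_group (K : Type*) [Field K] [IsArtinianRing (MonoidAlgebra K G)] :
    Finite G := by
  have hGT : WellFoundedGT (Subgroup G) := (subgroupIdeal_strictMono (K := K)).wellFoundedGT
  by_contra hinf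
  obtain ⟨N, ⟨hN, hNinf⟩, hmax⟩ := wellFounded_gt.has_min
    {N : Subgroup G | N.Normal ∧ ¬ N.FiniteIndex}
    ⟨⊥, inferInstance, fun h ↦ hinf (Finite.of_subgroup_quotient (H := ⊥))⟩
  have hart : IsArtinianRing (MonoidAlgebra K (G ⧸ N)) :=
    Function.Surjective.isArtinianRing (f := mapDomainRingHom K (QuotientGroup.mk' N)) fun x ↦ by
      obtain ⟨y, hy⟩ := Finsupp.mapDomain_surjective (M := K) (QuotientGroup.mk'_surjective N) x.coeff
      exact ⟨ofCoeff y, coeff_injective hy⟩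
  have := (subgroupIdeal_strictMono (K := K) (G := G ⧸ N)).wellFoundedGT
  have := (subgroupIdeal_strictMono (K := K) (G := G ⧸ N)).wellFoundedLT
  have hnormal (P : Subgroup (G ⧸ N)) (hP : P.Normal) (hPb : P ≠ ⊥) : P.FiniteIndex := by
    have hs := QuotientGroup.mk'_surjective N
    by_contra hPi
    refine hmax (P.comap (QuotientGroup.mk' N)) ⟨hP.comap _, fun h ↦ hPi ⟨?_⟩⟩ ?_
    · rw [← Subgroup.index_comap_of_surjective P hs]
      exact h.index_ne_zero
    · refine (QuotientGroup.ker_mk' N).symm.trans_lt ?_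
      rw [← MonoidHom.comap_bot]
      exact (Subgroup.comap_lt_comap_of_surjective hs).2 (bot_lt_iff_ne_bot.2 hPb)
  refine hNinf (Subgroup.finiteIndex_iff_finite_quotient.2 ?_)
  by_contra hQ
  exact hQ <| finite_of_forall_not_finiteIndex_centralizer (K := K) fun g hg hgi ↦
    hQ (finite_of_finiteIndex_centralizer hnormal hg hgi)

end Group

section Monoid

variable {K M : Type*} [Monoid M]

/-- The left ideal of the monoid algebra spanned by a left ideal of the monoid. -/
noncomputable def supportedIdeal (K : Type*) {M : Type*} [Semiring K] [Monoid M]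
    (S : SubMulAction M M) : Ideal (MonoidAlgebra K M) where
  carrier := {a | (a.coeff.support : Set M) ⊆ S}
  add_mem' := fun {a b} ha hb ↦ by
    classical
    refine (Finset.coe_subset.2 Finsupp.support_add).trans ?_
    rw [Finset.coe_union]
    exact Set.union_subset ha hb
  zero_mem' := by simp
  smul_mem' := fun c a ha ↦ by
    classical
    intro m hm
    rw [Finset.mem_coe, Finsupp.mem_support_iff, smul_eq_mul, coeff_mul] at hm
    obtain ⟨x, -, hx⟩ := Finset.exists_ne_zero_of_sum_ne_zero hm
    obtain ⟨y, hy, hxy⟩ := Finset.exists_ne_zero_of_sum_ne_zero hx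
    obtain rfl : x * y = m := by
      by_contra h
      exact hxy (if_neg h)
    exact S.smul_mem x (ha hy)

lemma single_one_mem_supportedIdeal_iff [Semiring K] [Nontrivial K] {S : SubMulAction M M} {m : M} :
    (single m 1 : MonoidAlgebra K M) ∈ supportedIdeal K S ↔ m ∈ S := by
  have : (single m 1 : MonoidAlgebra K M).coeff.support = {m} :=
    Finsupp.support_single m one_ne_zero
  change ((_ : Finset M) : Set M) ⊆ _ ↔ _
  rw [this]
  simp

lemma supportedIdeal_strictMono [Semiring K] [Nontrivial K] :
    StrictMono (supportedIdeal K : SubMulAction M M → _) :=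
  Monotone.strictMono_of_injective (fun _ _ h _ ha _ hm ↦ h (ha hm)) fun S T h ↦ by
    ext m
    rw [← single_one_mem_supportedIdeal_iff (K := K), h, single_one_mem_supportedIdeal_iff]

/-- A monoid with left Artinian monoid algebra satisfies the descending chain condition on left
ideals. -/
lemma wellFoundedLT_subMulAction (K : Type*) [Ring K] [Nontrivial K]
    [IsArtinianRing (MonoidAlgebra K M)] : WellFoundedLT (SubMulAction M M) :=
  (supportedIdeal_strictMono (K := K)).wellFoundedLT

lemma exists_mul_pow_mul_pow_eq [WellFoundedLT (SubMulAction M M)] (t : M) :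
    ∃ n, ∃ s : M, s * (t ^ (n + 1) * t ^ (n + 1)) = t ^ (n + 1) := by
  let S : M → SubMulAction M M := fun a ↦
    { carrier := Set.range (· * a)
      smul_mem' := by rintro c _ ⟨x, rfl⟩; exact ⟨c * x, mul_assoc _ _ _⟩ }
  obtain ⟨n, hn⟩ := WellFoundedGT.monotone_chain_condition (α := (SubMulAction M M)ᵒᵈ)
    ⟨fun n ↦ OrderDual.toDual (S (t ^ (n + 1))), monotone_nat_of_le_succ fun n ↦ by
      rintro _ ⟨x, rfl⟩
      refine ⟨x * t, ?_⟩
      change x * t * t ^ (n + 1) = x * t ^ (n + 1 + 1)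
      rw [mul_assoc, ← pow_succ']⟩
  have h : t ^ (n + 1) ∈ S (t ^ (2 * n + 1 + 1)) := by
    have := hn (2 * n + 1) (by omega)
    simp only [OrderHom.coe_mk, OrderDual.toDual_inj] at this
    rw [← this]
    exact ⟨1, one_mul _⟩
  obtain ⟨s, hs⟩ := h
  refine ⟨n, s, ?_⟩
  rw [← pow_add]
  convert hs using 3
  omega

/-- If the monoid algebra is left Noetherian and `u` generates the same left ideal of the monoid as
its square, then this left ideal contains an idempotent acting as the identity on `u`. -/
lemma exists_isIdempotentElem_of_mul_mul_eq (K : Type*) [Ring K] [Nontrivial K]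
    [IsNoetherianRing (MonoidAlgebra K M)] {u s : M} (h : s * (u * u) = u) :
    IsIdempotentElem (s * u) := by
  let A := MonoidAlgebra K M
  let p : Ideal A := Ideal.span {single u 1}
  let f : A →ₗ[A] A := LinearMap.toSpanSingleton A A (single u 1)
  have hf : ∀ x ∈ p, f x ∈ p := fun x _ ↦
    p.mul_mem_left x (Ideal.subset_span rfl)
  have hval (x : p) : (f.restrict hf x : A) = x.1 * single u 1 := rfl
  have hsurj : Function.Surjective (f.restrict hf) := by
    rintro ⟨x, hx⟩
    obtain ⟨a, rfl⟩ := Ideal.mem_span_singleton'.1 hx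
    refine ⟨⟨a * single (s * u) 1, ?_⟩, Subtype.ext ?_⟩
    · refine Ideal.mem_span_singleton'.2 ⟨a * single s 1, ?_⟩
      rw [mul_assoc, single_mul_single, mul_one]
    · rw [hval, mul_assoc, single_mul_single, mul_one, mul_assoc, h]
  have hinj := IsNoetherian.injective_of_surjective_endomorphism _ hsurj
  have hmem (x : M) : (single (x * u) 1 : A) ∈ p :=
    Ideal.mem_span_singleton'.2 ⟨single x 1, by rw [single_mul_single, mul_one]⟩
  have key := @hinj ⟨single (s * u * s * u) 1, hmem _⟩ ⟨single (s * u) 1, hmem _⟩ (Subtype.ext (by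
    rw [hval, hval, single_mul_single, single_mul_single]
    congr 1
    simp only [mul_assoc, h]))
  have := single_left_injective (one_ne_zero (α := K)) (Subtype.ext_iff.1 key)
  rw [IsIdempotentElem, ← mul_assoc, this]

section Corner

variable {e : M}

/-- The corner `eMe` of a monoid at an idempotent is a monoid with identity `e`. -/
instance (he : IsIdempotentElem e) : Monoid he.Corner where
  mul x y := ⟨x.1 * y.1, (Subsemigroup.corner e).mul_mem x.2 y.2⟩
  mul_assoc _ _ _ := Subtype.ext (mul_assoc _ _ _)
  one := ⟨e, (Subsemigroup.mem_corner_iff he).2 ⟨he, he⟩⟩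
  one_mul x := Subtype.ext ((Subsemigroup.mem_corner_iff he).1 x.2).1
  mul_one x := Subtype.ext ((Subsemigroup.mem_corner_iff he).1 x.2).2

/-- The map `m ↦ e * m * e` from a monoid to its corner at `e`. -/
def toCorner (he : IsIdempotentElem e) (m : M) : he.Corner := ⟨e * m * e, m, rfl⟩

variable (he : IsIdempotentElem e)

lemma coe_mul_corner (x y : he.Corner) : (x * y).1 = x.1 * y.1 := rfl

lemma coe_one_corner : (1 : he.Corner).1 = e := rfl

lemma mul_coe_corner (x : he.Corner) : e * x.1 = x.1 :=
  ((Subsemigroup.mem_corner_iff he).1 x.2).1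

lemma coe_corner_mul (x : he.Corner) : x.1 * e = x.1 :=
  ((Subsemigroup.mem_corner_iff he).1 x.2).2

lemma toCorner_mul_coe (m : M) (x : he.Corner) : toCorner he (m * x.1) = toCorner he m * x := by
  apply Subtype.ext
  rw [coe_mul_corner]
  simp only [toCorner, mul_assoc, coe_corner_mul, mul_coe_corner]

lemma toCorner_one : toCorner he 1 = 1 :=
  Subtype.ext (by simp only [toCorner, mul_one]; exact he)

lemma isArtinianRing_units_corner [Ring K] [IsArtinianRing (MonoidAlgebra K M)] :
    IsArtinianRing (MonoidAlgebra K he.Cornerˣ) := by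
  classical
  let π : MonoidAlgebra K M →+ MonoidAlgebra K he.Cornerˣ :=
    (Finsupp.liftAddHom fun m : M ↦ if h : IsUnit (toCorner he m) then singleAddHom h.unit
      else 0).comp (coeffAddEquiv (R := K) (M := M)).toAddMonoidHom
  have hπ (m : M) (r : K) :
      π (single m r) = if h : IsUnit (toCorner he m) then single h.unit r else 0 := by
    simp only [π, AddMonoidHom.comp_apply]
    erw [Finsupp.liftAddHom_apply_single]
    split_ifs <;> rfl
  refine .of_addMonoidHom π (mapDomain fun g : he.Cornerˣ ↦ g.1.1) (fun a b ↦ ?_) ?_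
  · induction b using MonoidAlgebra.induction_linear with
    | zero => simp
    | add x y hx hy => rw [mapDomain_add, mul_add, map_add, hx, hy, mul_add]
    | single g s =>
      induction a using MonoidAlgebra.induction_linear with
      | zero => simp
      | add x y hx hy => rw [add_mul, map_add, hx, hy, map_add, add_mul]
      | single m r =>
        rw [mapDomain_single, single_mul_single, hπ, hπ]
        by_cases h : IsUnit (toCorner he m)
        · have h' : IsUnit (toCorner he (m * g.1.1)) := by
            rw [toCorner_mul_coe]; exact h.mul g.isUnit
          rw [dif_pos h, dif_pos h', single_mul_single]
          congr 1
          ext1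
          simp [toCorner_mul_coe]
        · have h' : ¬ IsUnit (toCorner he (m * g.1.1)) := by
            rwa [toCorner_mul_coe, Units.isUnit_mul_units]
          rw [dif_neg h, dif_neg h', zero_mul]
  · rw [one_def, hπ, dif_pos (by rw [toCorner_one]; exact isUnit_one), one_def]
    congr 1
    ext1
    simp [toCorner_one]

lemma isDedekindFiniteMonoid_corner (K : Type*) [Ring K] [Nontrivial K]
    [IsNoetherianRing (MonoidAlgebra K M)] : IsDedekindFiniteMonoid he.Corner where
  mul_eq_one_symm {x y} hxy := by
    let E : MonoidAlgebra K M := single e 1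
    let f (x : he.Corner) : MonoidAlgebra K M := single x.1 1 + (1 - E)
    have hE : E * E = E := by simp only [E, single_mul_single, mul_one, he.eq]
    have hf (x y : he.Corner) : f x * f y = f (x * y) := by
      have h1 : single x.1 1 * E = single x.1 1 := by
        simp only [E, single_mul_single, mul_one, coe_corner_mul]
      have h2 : E * single y.1 1 = single y.1 1 := by
        simp only [E, single_mul_single, mul_one, mul_coe_corner]
      simp only [f, add_mul, mul_add, sub_mul, mul_sub, one_mul, mul_one, h1, h2, hE, sub_self,
        add_zero, single_mul_single, coe_mul_corner]
      abel
    have hf1 : f 1 = 1 := by simp only [f, coe_one_corner]; abel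
    have h : f y * f x = 1 := mul_eq_one_comm.1 (by rw [hf, hxy, hf1])
    rw [hf, ← hf1, add_left_inj] at h
    exact Subtype.ext (single_left_injective (one_ne_zero (α := K)) h)

end Corner

end Monoid

/-- Given a proper ideal `P` of a monoid with the prime-like property that every `z ∉ P` satisfies
`z * m * z ∉ P` for some `m`, the descending chain condition yields an idempotent which generates a
two-sided ideal minimal among those not contained in `P`. -/
lemma exists_isIdempotentElem_minimal {M : Type*} [Monoid M] [WellFoundedLT (SubMulAction M M)]
    (hM : ∀ u s : M, s * (u * u) = u → IsIdempotentElem (s * u)) (P : Set M) (h1 : 1 ∉ P)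
    (hr : ∀ a, ∀ m ∈ P, m * a ∈ P)
    (hP : ∀ z ∉ P, ∃ m, z * m * z ∉ P) :
    ∃ e, IsIdempotentElem e ∧ e ∉ P ∧
      ∀ w ∉ P, (∃ x y, w = x * e * y) → ∃ x y, e = x * w * y := by
  let T : M → SubMulAction M M := fun z ↦
    { carrier := {w | ∃ x y, w = x * z * y}
      smul_mem' := by
        rintro c _ ⟨x, y, rfl⟩
        exact ⟨c * x, y, by simp only [smul_eq_mul, mul_assoc]⟩ }
  have hT {w z : M} (h : w ∈ T z) : T w ≤ T z := by
    obtain ⟨x, y, rfl⟩ := h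
    rintro _ ⟨x', y', rfl⟩
    exact ⟨x' * x, y * y', by simp only [mul_assoc]⟩
  have hself (z : M) : z ∈ T z := ⟨1, 1, by simp⟩
  obtain ⟨_, ⟨z, hz, rfl⟩, hmin⟩ := wellFounded_lt.has_min (T '' Pᶜ) ⟨_, 1, h1, rfl⟩
  replace hmin (w : M) (hw : w ∉ P) (hwz : w ∈ T z) : z ∈ T w := by
    by_contra h
    exact hmin _ ⟨w, hw, rfl⟩ ((hT hwz).lt_of_not_ge fun h' ↦ h (h' (hself z)))
  obtain ⟨m, hm⟩ := hP z hz
  obtain ⟨p, q, hpq⟩ := hmin _ hm ⟨1, m * z, by simp only [one_mul, mul_assoc]⟩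
  have htn (n : ℕ) : z = (p * z * m) ^ n * z * q ^ n := by
    induction n with
    | zero => simp
    | succ n ih =>
      calc z = (p * z * m) ^ n * z * q ^ n := ih
        _ = (p * z * m) ^ n * (p * (z * m * z) * q) * q ^ n := by rw [← hpq]
        _ = _ := by rw [pow_succ, pow_succ']; simp only [mul_assoc]
  have htP (n : ℕ) : (p * z * m) ^ n ∉ P := fun h ↦ hz (by
    rw [htn n]; exact hr _ _ (hr _ _ h))
  obtain ⟨n, s, hs⟩ := exists_mul_pow_mul_pow_eq (p * z * m)
  refine ⟨_, hM _ _ hs, fun h ↦ htP (n + 1) ?_, fun w hw hwe ↦ ?_⟩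
  · rw [← hs, ← mul_assoc]; exact hr _ _ h
  · have he : s * (p * z * m) ^ (n + 1) ∈ T z :=
      ⟨s * (p * z * m) ^ n * p, m, by rw [pow_succ]; simp only [mul_assoc]⟩
    exact hT (hmin w hw (hT he hwe)) he

section Simple

variable {K M V : Type*} [Field K] [Monoid M] [AddCommGroup V] [Module K V]
  [Module (MonoidAlgebra K M) V] [IsScalarTower K (MonoidAlgebra K M) V]

lemma smul_mem_of_forall_single_smul_mem (W : Submodule K V) {v : V}
    (h : ∀ m : M, (single m 1 : MonoidAlgebra K M) • v ∈ W) (a : MonoidAlgebra K M) :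
    a • v ∈ W := by
  induction a using MonoidAlgebra.induction_linear with
  | zero => simp
  | add x y hx hy => rw [add_smul]; exact add_mem hx hy
  | single m r =>
    have : (single m r : MonoidAlgebra K M) = r • single m 1 := by simp
    rw [this, smul_assoc]
    exact W.smul_mem r (h m)

omit [Field K] [Module K V] [IsScalarTower K (MonoidAlgebra K M) V] in
lemma exists_smul_eq_of_isSimpleModule {R : Type*} [Ring R] [Module R V] [IsSimpleModule R V]
    {v : V} (hv : v ≠ 0) (w : V) : ∃ a : R, a • v = w :=
  IsSimpleModule.toSpanSingleton_surjective R hv w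

omit [Module K V] [IsScalarTower K (MonoidAlgebra K M) V] in
lemma single_one_mul_smul (x y : M) (v : V) :
    (single (x * y) 1 : MonoidAlgebra K M) • v =
      (single x 1 : MonoidAlgebra K M) • (single y 1 : MonoidAlgebra K M) • v := by
  rw [← mul_smul, single_mul_single, mul_one]

/-- If the monoid algebra is left Artinian, then for a simple module there is an idempotent `e` of
the monoid not annihilating it and such that each element of `e M e` annihilates the module or is
invertible in `e M e`. -/
lemma exists_isIdempotentElem_isUnit [IsArtinianRing (MonoidAlgebra K M)]
    [IsSimpleModule (MonoidAlgebra K M) V] :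
    ∃ (e : M) (he : IsIdempotentElem e), (∃ v : V, (single e 1 : MonoidAlgebra K M) • v ≠ 0) ∧
      ∀ g : he.Corner, (∃ v : V, (single g.1 1 : MonoidAlgebra K M) • v ≠ 0) → IsUnit g := by
  have := wellFoundedLT_subMulAction (M := M) K
  let P : Set M := {m | ∀ v : V, (single m 1 : MonoidAlgebra K M) • v = 0}
  have hP (m : M) : m ∉ P ↔ ∃ v : V, (single m 1 : MonoidAlgebra K M) • v ≠ 0 := by
    simp [P]
  have := IsSimpleModule.nontrivial (MonoidAlgebra K M) V
  obtain ⟨e, he, heP, hmin⟩ := exists_isIdempotentElem_minimal (M := M)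
    (fun u s h ↦ exists_isIdempotentElem_of_mul_mul_eq K h) P
    (by
      obtain ⟨v, hv⟩ := exists_ne (0 : V)
      exact (hP 1).2 ⟨v, by rwa [← one_def, one_smul]⟩)
    (fun a m hm v ↦ by rw [single_one_mul_smul, hm])
    (fun z hz ↦ by
      by_contra! h
      obtain ⟨v, hv⟩ := (hP z).1 hz
      obtain ⟨a, ha⟩ := exists_smul_eq_of_isSimpleModule (R := MonoidAlgebra K M) hv v
      refine hv ?_
      rw [← ha, ← Submodule.mem_bot K]
      have (b : MonoidAlgebra K M) : (single z 1 : MonoidAlgebra K M) • b •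
          (single z 1 : MonoidAlgebra K M) • v = 0 := by
        induction b using MonoidAlgebra.induction_linear with
        | zero => simp
        | add x y hx hy => rw [add_smul, smul_add, hx, hy, add_zero]
        | single m r =>
          rw [← mul_smul, ← mul_smul, single_mul_single, single_mul_single]
          have : (single (z * m * z) (1 * r * 1) : MonoidAlgebra K M) =
            r • single (z * m * z) 1 := by simp
          rw [this, smul_assoc, h m v, smul_zero]
      exact this a)
  have := isDedekindFiniteMonoid_corner he K
  refine ⟨e, he, (hP e).1 heP, fun g hg ↦ ?_⟩
  obtain ⟨p, q, hpq⟩ := hmin g.1 ((hP _).2 hg) ⟨g.1, 1, by rw [coe_corner_mul, mul_one]⟩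
  have h : toCorner he p * g * toCorner he q = 1 := by
    apply Subtype.ext
    rw [coe_mul_corner, coe_mul_corner, coe_one_corner]
    calc e * p * e * g.1 * (e * q * e) = e * (p * (e * (g.1 * e)) * q) * e := by
          simp only [mul_assoc]
      _ = e := by rw [coe_corner_mul, mul_coe_corner, ← hpq, he.eq, he.eq]
  have h' : g * (toCorner he q * toCorner he p) = 1 := by
    rw [mul_eq_one_comm, mul_assoc, mul_eq_one_comm, h]
  exact IsUnit.of_mul_eq_one _ h'

/-- A simple module over a left Artinian monoid algebra over a field is finite-dimensional. -/
lemma finite_of_isSimpleModule [IsArtinianRing (MonoidAlgebra K M)]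
    [IsSimpleModule (MonoidAlgebra K M) V] : Module.Finite K V := by
  obtain ⟨e, he, ⟨v, hv⟩, hu⟩ := exists_isIdempotentElem_isUnit (K := K) (M := M) (V := V)
  have := isArtinianRing_units_corner he (K := K)
  have := finite_of_isArtinianRing_group (G := he.Cornerˣ) K
  let F : Submodule K V := Submodule.span K
    (Set.range fun g : he.Cornerˣ ↦ (single g.1.1 1 : MonoidAlgebra K M) • v)
  have : FiniteDimensional K F := FiniteDimensional.span_of_finite K (Set.finite_range _)
  let ρ : MonoidAlgebra K M →ₐ[K] Module.End K V := Algebra.lsmul K K V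
  have hF (w : V) : (single e 1 : MonoidAlgebra K M) • w ∈ F := by
    obtain ⟨a, rfl⟩ := exists_smul_eq_of_isSimpleModule (R := MonoidAlgebra K M) hv w
    refine smul_mem_of_forall_single_smul_mem (F.comap (ρ (single e 1))) (fun m ↦ ?_) a
    change (single e 1 : MonoidAlgebra K M) • (single m 1 : MonoidAlgebra K M) •
      (single e 1 : MonoidAlgebra K M) • v ∈ F
    rw [← single_one_mul_smul, ← single_one_mul_smul]
    by_cases h : (single (e * m * e) 1 : MonoidAlgebra K M) • v = 0
    · rw [h]; exact zero_mem _
    · exact Submodule.subset_span ⟨(hu (toCorner he m) ⟨v, h⟩).unit, rfl⟩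
  obtain ⟨T, hT, hspan⟩ := (Submodule.fg_span_iff_fg_span_finset_subset
    (Set.range fun m : M ↦ (single (e * m) 1 : MonoidAlgebra K M))).1
      (IsNoetherian.noetherian (R := MonoidAlgebra K M) _)
  let Φ : V →ₗ[K] T → F := LinearMap.pi fun b ↦ (ρ b).codRestrict F fun w ↦ by
    obtain ⟨m, hm⟩ := hT b.2
    change (b : MonoidAlgebra K M) • w ∈ F
    rw [← hm]
    change (single (e * m) 1 : MonoidAlgebra K M) • w ∈ F
    rw [single_one_mul_smul]
    exact hF _
  refine Module.Finite.of_injective Φ ((injective_iff_map_eq_zero Φ).2 fun w hw ↦ ?_)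
  by_contra hw0
  have hle : Submodule.span (MonoidAlgebra K M)
      (Set.range fun m : M ↦ (single (e * m) 1 : MonoidAlgebra K M)) ≤
        LinearMap.ker (LinearMap.toSpanSingleton (MonoidAlgebra K M) V w) := by
    rw [hspan, Submodule.span_le]
    intro b hb
    exact congrArg Subtype.val (congrFun hw ⟨b, hb⟩)
  obtain ⟨a, rfl⟩ := exists_smul_eq_of_isSimpleModule (R := MonoidAlgebra K M) hw0 v
  refine hv ?_
  refine smul_mem_of_forall_single_smul_mem (LinearMap.ker (ρ (single e 1))) (fun m ↦ ?_) a
  change (single e 1 : MonoidAlgebra K M) • (single m 1 : MonoidAlgebra K M) • w = 0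
  rw [← single_one_mul_smul]
  exact hle (Submodule.subset_span ⟨m, rfl⟩)

omit [AddCommGroup V] [Module K V] [Module (MonoidAlgebra K M) V]
  [IsScalarTower K (MonoidAlgebra K M) V] in
lemma finite_of_isFiniteLength [IsArtinianRing (MonoidAlgebra K M)] {V : Type*} [AddCommGroup V]
    [Module (MonoidAlgebra K M) V] (h : IsFiniteLength (MonoidAlgebra K M) V) [Module K V]
    [IsScalarTower K (MonoidAlgebra K M) V] : Module.Finite K V := by
  revert ‹Module K V›
  induction h with
  | of_subsingleton => intros; infer_instance
  | @of_simple_quotient V _ _ N _ _ ih =>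
    intro _ _
    have h : Module.Finite K (V ⧸ N) := finite_of_isSimpleModule (M := M)
    have h' : Module.Finite K (V ⧸ N.restrictScalars K) := h
    have ih' : Module.Finite K (N.restrictScalars K) := (ih : Module.Finite K N)
    exact Module.Finite.of_submodule_quotient (N.restrictScalars K)

end Simple

/-- A theorem of Zelmanov: a monoid whose monoid algebra over a field is left Artinian is
finite. -/
theorem finite_of_isArtinianRing (K : Type*) {M : Type*} [Field K] [Monoid M]
    [IsArtinianRing (MonoidAlgebra K M)] : Finite M := by
  have : Module.Finite K (MonoidAlgebra K M) := finite_of_isFiniteLength (M := M)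
    ((isArtinianRing_iff_isFiniteLength _).1 inferInstance)
  exact Module.Finite.finite_basis (basis M K)

/-- A left Artinian monoid algebra over a commutative ring is also right Artinian. -/
theorem isArtinian_op (k : Type*) {M : Type*} [CommRing k] [Monoid M]
    [IsArtinianRing (MonoidAlgebra k M)] :
    IsArtinian (MonoidAlgebra k M)ᵐᵒᵖ (MonoidAlgebra k M) := by
  cases subsingleton_or_nontrivial k
  · have : Subsingleton (MonoidAlgebra k M) := coeff_injective.subsingleton
    infer_instance
  have haug : Function.Surjective (lift k k M 1) := fun r ↦ ⟨single 1 r, by simp⟩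
  have : IsArtinianRing k := haug.isArtinianRing
  obtain ⟨m, hm⟩ := Ideal.exists_maximal k
  let := Ideal.Quotient.field m
  have hmap : Function.Surjective (mapRingHom M (Ideal.Quotient.mk m)) :=
    map_surjective (Ideal.Quotient.mk m).toAddMonoidHom Ideal.Quotient.mk_surjective
  have : IsArtinianRing (MonoidAlgebra (k ⧸ m) M) := hmap.isArtinianRing
  have := finite_of_isArtinianRing (k ⧸ m) (M := M)
  have : Module.Finite k (MonoidAlgebra k M) := .of_basis (basis M k)
  exact isArtinian_of_tower k inferInstance

end MonoidAlgebra

section Pd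

variable {k : Type} [CommRing k] {D : Type} [SmallCategory D] {d : D}

/-- The value of `P^d` at `d` is the monoid algebra of `End d`. -/
noncomputable def pdEquiv (k : Type) [CommRing k] {D : Type} [SmallCategory D] (d : D) :
    (Pd k d).obj d ≃ₗ[k] MonoidAlgebra k (End d) :=
  (MonoidAlgebra.coeffLinearEquiv k (M := End d) (S := k)).symm

lemma pdEquiv_map (h : d ⟶ d) (a : MonoidAlgebra k (End d)) :
    pdEquiv k d ((Pd k d).map h ((pdEquiv k d).symm a)) =
      (MonoidAlgebra.single h 1 : MonoidAlgebra k (End d)) * a := by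
  induction a using MonoidAlgebra.induction_linear with
  | zero => simp
  | add x y hx hy => rw [map_add, map_add, map_add, hx, hy, mul_add]
  | single f r =>
    rw [MonoidAlgebra.single_mul_single, one_mul]
    exact congrArg MonoidAlgebra.ofCoeff (Finsupp.mapDomain_single (f := (· ≫ h)) (a := f) (b := r))

/-- The largest subrepresentation of `P^d` whose value at `d` is contained in a given left ideal of
the monoid algebra of `End d`. -/
noncomputable def subrepOfIdeal (L : Ideal (MonoidAlgebra k (End d))) : Subrep k (Pd k d) where
  toFun x := ⨅ h : x ⟶ d,
    (L.restrictScalars k).comap ((pdEquiv k d).toLinearMap ∘ₗ ((Pd k d).map h).hom)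
  map_mem {x y} f v hv := by
    simp only [Submodule.mem_iInf] at hv ⊢
    intro h
    have := hv (f ≫ h)
    rw [Functor.map_comp] at this
    exact this

lemma pdEquiv_symm_mem_subrepOfIdeal_iff (L : Ideal (MonoidAlgebra k (End d)))
    (a : MonoidAlgebra k (End d)) :
    (pdEquiv k d).symm a ∈ (subrepOfIdeal L).toFun d ↔ a ∈ L := by
  have (h : d ⟶ d) : (pdEquiv k d).symm a ∈ (L.restrictScalars k).comap
      ((pdEquiv k d).toLinearMap ∘ₗ ((Pd k d).map h).hom) ↔
        (MonoidAlgebra.single h 1 : MonoidAlgebra k (End d)) * a ∈ L := by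
    rw [← pdEquiv_map]
    rfl
  simp only [subrepOfIdeal, Submodule.mem_iInf, this]
  refine ⟨fun h ↦ ?_, fun h f ↦ L.mul_mem_left _ h⟩
  have := h (1 : End d)
  rwa [← MonoidAlgebra.one_def, one_mul] at this

lemma isArtinianRing_of_wellFoundedLT_subrep [WellFoundedLT (Subrep k (Pd k d))] :
    IsArtinianRing (MonoidAlgebra k (End d)) := by
  have hmono : Monotone (subrepOfIdeal : Ideal (MonoidAlgebra k (End d)) → _) :=
    fun L L' hL x ↦ iInf_mono fun h ↦ Submodule.comap_mono hL
  refine (hmono.strictMono_of_injective fun L L' hL ↦ ?_).wellFoundedLT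
  ext a
  rw [← pdEquiv_symm_mem_subrepOfIdeal_iff, hL, pdEquiv_symm_mem_subrepOfIdeal_iff]

lemma isFinGen_Pd (k : Type) [CommRing k] {D : Type} [SmallCategory D] (d : D) :
    IsFinGen k (Pd k d) := by
  refine ⟨1, fun _ ↦ d, fun _ ↦ (Finsupp.single (𝟙 d) 1 : (d ⟶ d) →₀ k), fun W hW x ↦ ?_⟩
  rw [eq_top_iff]
  rintro (v : (d ⟶ x) →₀ k) -
  induction v using Finsupp.induction_linear with
  | zero => exact zero_mem (W.toFun x)
  | add v w hv hw => exact add_mem (S := Submodule k ((Pd k d).obj x)) hv hw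
  | single f r =>
    have h : (Pd k d).map f (Finsupp.single (𝟙 d) 1 : (d ⟶ d) →₀ k) =
        (Finsupp.single f 1 : (d ⟶ x) →₀ k) :=
      (Finsupp.mapDomain_single (f := (· ≫ f)) (a := 𝟙 d) (b := (1 : k))).trans (by simp)
    have h' := (W.toFun x).smul_mem r (W.map_mem f _ (hW 0))
    rw [h] at h'
    rw [← mul_one r, ← smul_eq_mul, ← Finsupp.smul_single]
    exact h'

end Pd

/-- If the monoid algebra `k[End_D(d)]` fails the descending chain condition on right
ideals, then `P^d` admits an infinite strictly decreasing chain of subrepresentations;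
in particular `D` is not dimension zero over `k`. -/
theorem stmt17 (k : Type) [CommRing k] {D : Type} [SmallCategory D] (d : D)
    (hdcc : ¬ IsArtinian (MonoidAlgebra k (End d))ᵐᵒᵖ (MonoidAlgebra k (End d))) :
    (∃ c : ℕ → Subrep k (Pd k d), StrictAnti c) ∧ ¬ DimZero k D := by
  have hP : ∃ c : ℕ → Subrep k (Pd k d), StrictAnti c := by
    by_contra h
    have : WellFoundedLT (Subrep k (Pd k d)) := by
      refine ⟨RelEmbedding.wellFounded_iff_isEmpty.2 ⟨fun f ↦ h ⟨f, ?_⟩⟩⟩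
      exact fun a b hab ↦ f.map_rel_iff.2 hab
    have := isArtinianRing_of_wellFoundedLT_subrep (k := k) (d := d)
    exact hdcc (MonoidAlgebra.isArtinian_op k)
  refine ⟨hP, fun hD ↦ ?_⟩
  obtain ⟨c, hc⟩ := hP
  have := (hD _ (isFinGen_Pd k d)).1
  exact not_strictAnti_of_wellFoundedLT c hc
end
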